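/- Let $R$ be a ring and $f : C_\bullet \to D_\bullet$ a chain map between connective chain complexes of projective right $R$-modules. Then $f$ is a chain homotopy equivalence if and only if $f$ is a quasi-isomorphism (i.e. $f_* : H_p(C_\bullet) \to H_p(D_\bullet)$ is an isomorphism for all $p$). -/

import Mathlib

open CategoryTheory

universe u v

/-- Let `R` be a ring and `f : C_• → D_•` a chain map between connective
chain complexes of projective `R`-modules.  Then `f` is a chain homotopy equivalence
if and only if `f` is a quasi-isomorphism. -/
theorem homotopyEquiv_iff_quasiIso
    {R : Type u} [Ring R] (C D : ChainComplex (ModuleCat.{v} R) ℕ)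
    (hC : ∀ p, Module.Projective R (C.X p)) (hD : ∀ p, Module.Projective R (D.X p))
    (f : C ⟶ D) :
    (∃ e : HomotopyEquiv C D, e.hom = f) ↔ QuasiIso f := by
  have (p : ℕ) : Projective (C.X p) :=
    have := hC p
    inferInstance
  have (p : ℕ) : Projective (D.X p) :=
    have := hD p
    inferInstance
  exact (ChainComplex.quasiIso_iff_of_projective f).symm
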